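/- arXiv:2112.03543 — 3 statements merged into one kernel-verified Lean document; each statement's English description precedes it below -/
import Mathlib

section
/- Let p ∈ (0,1) and let ε > 0 be a constant with ε < 1/4. For the 3-Majority dynamics with uniform noise probability p and all sufficiently large n, if s is a bias value with 0 < |s| ≤ √n/ε, then the majority opinion switches at the next round (the sign of s_t is opposite to that of s) with probability at least e^{−9/(2ε²)}, a positive constant depending only on ε. -/
/-- The probability that a fixed node adopts opinion `beta` in one round of the
`3-Majority` dynamics with uniform communication noise probability `p`, on the complete
graph on `n` nodes, given that the current bias (#beta − #alpha) is `s`.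
With `b' = ((n+s)/(2n))·(1−p) + p/2` and `a' = ((n−s)/(2n))·(1−p) + p/2`, it equals
`b'^3 + 3·a'·b'^2`. -/
noncomputable def qStep (n : ℕ) (p : ℝ) (s : ℤ) : ℝ :=
  ((((n : ℝ) + (s : ℝ)) / (2 * (n : ℝ))) * (1 - p) + p / 2) ^ 3 +
    3 * ((((n : ℝ) - (s : ℝ)) / (2 * (n : ℝ))) * (1 - p) + p / 2) *
      ((((n : ℝ) + (s : ℝ)) / (2 * (n : ℝ))) * (1 - p) + p / 2) ^ 2

/-- Probability that `b_t = k` (i.e. exactly `k` nodes adopt beta), given `s_{t-1} = s`: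
the binomial distribution `Binomial(n, qStep n p s)`. -/
noncomputable def binomProb (n : ℕ) (p : ℝ) (s : ℤ) (k : ℕ) : ℝ :=
  (n.choose k : ℝ) * qStep n p s ^ k * (1 - qStep n p s) ^ (n - k)

open scoped Classical in
/-- One-step probability of the event `A` for the new bias `s_t = 2·b_t − n`,
conditional on `s_{t-1} = s`. -/
noncomputable def stepProb (n : ℕ) (p : ℝ) (s : ℤ) (A : ℤ → Prop) : ℝ :=
  ∑ k ∈ Finset.range (n + 1), if A (2 * (k : ℤ) - (n : ℤ)) then binomProb n p s k else 0

/-- One-step expectation of `f (s_t)` conditional on `s_{t-1} = s`. -/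
noncomputable def stepExp (n : ℕ) (p : ℝ) (s : ℤ) (f : ℤ → ℝ) : ℝ :=
  ∑ k ∈ Finset.range (n + 1), binomProb n p s k * f (2 * (k : ℤ) - (n : ℤ))

/-- The equilibrium bias `s_eq = (n/(1−p))·√((1−3p)/(1−p))`. -/
noncomputable def sEq (n : ℕ) (p : ℝ) : ℝ :=
  ((n : ℝ) / (1 - p)) * Real.sqrt ((1 - 3 * p) / (1 - p))

/-- Bias trajectory: `ω t` records the number of beta-nodes at round `t+1`;
the bias at time `0` is `s0` and at time `t+1` it is `2·(ω t) − n`. -/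
def biasAt (n : ℕ) (s0 : ℤ) (ω : ℕ → Fin (n + 1)) : ℕ → ℤ
  | 0 => s0
  | t + 1 => 2 * ((ω t).val : ℤ) - (n : ℤ)

/-- Probability of the first `t` steps of the trajectory `ω` of the Markov chain started
at bias `s0` (product of one-step binomial probabilities). -/
noncomputable def trajP (n : ℕ) (p : ℝ) (s0 : ℤ) (ω : ℕ → Fin (n + 1)) : ℕ → ℝ
  | 0 => 1
  | t + 1 => trajP n p s0 ω t * binomProb n p (biasAt n s0 ω t) (ω t).val

/-- Extend a finite path to an infinite one (junk after time `T`). -/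
def extendPath (n T : ℕ) (ω : Fin T → Fin (n + 1)) : ℕ → Fin (n + 1) :=
  fun t => if h : t < T then ω ⟨t, h⟩ else 0

open scoped Classical in
/-- Probability that the bias trajectory `(s_0, s_1, …, s_T)` of the 3-Majority Markov
chain with noise `p`, started from `s_0 = s0`, satisfies the event `E`. -/
noncomputable def trajProb (n : ℕ) (p : ℝ) (s0 : ℤ) (T : ℕ) (E : (ℕ → ℤ) → Prop) : ℝ :=
  ∑ ω : Fin T → Fin (n + 1),
    if E (biasAt n s0 (extendPath n T ω)) then trajP n p s0 (extendPath n T ω) T else 0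

open Finset in
lemma aux_var (n : ℕ) :
    ∑ k ∈ range (n + 1), (n.choose k : ℝ) * ((n : ℝ) - 2 * k) ^ 2 = (n : ℝ) * 2 ^ n := by
  have h := congrArg (Polynomial.eval (1 / 2 : ℝ)) (bernsteinPolynomial.variance ℝ n)
  simp only [Polynomial.eval_finsetSum, bernsteinPolynomial, nsmul_eq_mul,
    Polynomial.eval_mul, Polynomial.eval_pow, Polynomial.eval_sub,
    Polynomial.eval_natCast, Polynomial.eval_X, Polynomial.eval_one] at h
  have h2 : ∑ k ∈ range (n + 1), (n.choose k : ℝ) * ((n : ℝ) - 2 * k) ^ 2 =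
      4 * 2 ^ n * ∑ x ∈ range (n + 1), ((n : ℝ) * (1 / 2) - x) ^ 2 *
        ((n.choose x : ℝ) * (1 / 2) ^ x * (1 - 1 / 2) ^ (n - x)) := by
    rw [mul_sum]
    refine sum_congr rfl fun k hk => ?_
    have hk' : k ≤ n := by have := mem_range.1 hk; omega
    have e : ((1 : ℝ) / 2) ^ k * (1 - 1 / 2) ^ (n - k) * 2 ^ n = 1 := by
      rw [show (1 : ℝ) - 1 / 2 = 1 / 2 by norm_num, ← pow_add, Nat.add_sub_cancel' hk', ← mul_pow]
      norm_num
    linear_combination (-(4 * ((n : ℝ) * (1 / 2) - k) ^ 2 * (n.choose k : ℝ))) * e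
  rw [h2, h]; ring

open Finset in
lemma aux_half (n : ℕ) (hn : 1 ≤ n) :
    (2 : ℝ) ^ n ≤ 4 * ∑ k ∈ range (n + 1) with 2 * k < n, (n.choose k : ℝ) := by
  have htot : ∑ k ∈ range (n + 1), (n.choose k : ℝ) = 2 ^ n := by
    exact_mod_cast Nat.sum_range_choose n
  set H := ∑ k ∈ range (n + 1) with 2 * k < n, (n.choose k : ℝ) with hH
  have hH' : H = ∑ k ∈ range (n + 1), if 2 * k < n then (n.choose k : ℝ) else 0 := by
    rw [hH, sum_filter]
  have hup : H = ∑ k ∈ range (n + 1), if n < 2 * k then (n.choose k : ℝ) else 0 := by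
    rw [hH', ← sum_range_reflect]
    refine sum_congr rfl fun k hk => ?_
    have hk' : k ≤ n := by have := mem_range.1 hk; omega
    rw [show n + 1 - 1 - k = n - k by omega, Nat.choose_symm hk']
    exact if_congr (by omega) rfl rfl
  have hmid : ∑ k ∈ range (n + 1), (if 2 * k = n then (n.choose k : ℝ) else 0) ≤ 2 * H := by
    rcases Nat.even_or_odd' n with ⟨m, rfl | rfl⟩
    · obtain ⟨j, rfl⟩ : ∃ j, m = j + 1 := ⟨m - 1, by omega⟩
      rw [sum_eq_single (j + 1)]
      · have h1 : (((2 * (j + 1)).choose j : ℕ) : ℝ) ≤ H := by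
          rw [hH]
          exact single_le_sum (f := fun k => (((2 * (j + 1)).choose k : ℕ) : ℝ))
            (fun i _ => by positivity) (by simp; omega)
        have h2 := Nat.choose_succ_right_eq (2 * (j + 1)) j
        have h3 : (2 * (j + 1)).choose (j + 1) ≤ 2 * (2 * (j + 1)).choose j := by
          rw [show 2 * (j + 1) - j = j + 2 by omega] at h2
          by_contra hc
          push Not at hc
          nlinarith
        have h4 : (((2 * (j + 1)).choose (j + 1) : ℕ) : ℝ) ≤ 2 * ((2 * (j + 1)).choose j : ℕ) := by
          exact_mod_cast h3
        simp only [if_true]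
        linarith
      · intro b _ hb
        rw [if_neg (by omega)]
      · intro h; simp at h
    · rw [sum_eq_zero]
      · have : 0 ≤ H := sum_nonneg fun i _ => by positivity
        linarith
      · intro k _; rw [if_neg (by omega)]
  have hsplit : ∑ k ∈ range (n + 1), (n.choose k : ℝ) = H + H +
      ∑ k ∈ range (n + 1), (if 2 * k = n then (n.choose k : ℝ) else 0) := by
    nth_rewrite 1 [hH']
    rw [hup, ← sum_add_distrib, ← sum_add_distrib]
    refine sum_congr rfl fun k _ => ?_
    rcases lt_trichotomy (2 * k) n with h | h | h
    · rw [if_pos h, if_neg (by omega), if_neg (by omega)]; ring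
    · rw [if_neg (by omega), if_neg (by omega), if_pos h]; ring
    · rw [if_neg (by omega), if_pos h, if_neg (by omega)]; ring
  linarith

open Finset in
lemma aux_mass (n : ℕ) (hn : 1 ≤ n) :
    3 / 16 * (2 : ℝ) ^ n ≤ ∑ k ∈ range (n + 1) with
      (2 * k < n ∧ ((n : ℝ) - 2 * k) ^ 2 ≤ 16 * n), (n.choose k : ℝ) := by
  classical
  have h1 := aux_half n hn
  have h2 := aux_var n
  have hn0 : (0 : ℝ) < n := by exact_mod_cast hn
  rw [sum_filter] at h1 ⊢
  have h3 : 16 * (n : ℝ) * (∑ k ∈ range (n + 1), (if 2 * k < n then (n.choose k : ℝ) else 0)) ≤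
      16 * n * (∑ k ∈ range (n + 1),
        (if (2 * k < n ∧ ((n : ℝ) - 2 * k) ^ 2 ≤ 16 * n) then (n.choose k : ℝ) else 0)) +
      ∑ k ∈ range (n + 1), (n.choose k : ℝ) * ((n : ℝ) - 2 * k) ^ 2 := by
    rw [mul_sum, mul_sum, ← sum_add_distrib]
    refine sum_le_sum fun k _ => ?_
    have hc : (0 : ℝ) ≤ n.choose k := by positivity
    have hd : (0 : ℝ) ≤ (n.choose k : ℝ) * ((n : ℝ) - 2 * k) ^ 2 := by positivity
    by_cases ha : 2 * k < n
    · by_cases hb : ((n : ℝ) - 2 * k) ^ 2 ≤ 16 * n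
      · rw [if_pos ha, if_pos ⟨ha, hb⟩]; linarith
      · rw [if_pos ha, if_neg (fun h => hb h.2)]
        push Not at hb
        nlinarith
    · rw [if_neg ha, if_neg (fun h => ha h.1)]; linarith
  rw [h2] at h3
  have h4 : 0 < (n : ℝ) := hn0
  nlinarith

lemma aux_exp (y : ℝ) (h0 : 0 ≤ y) (h1 : y ≤ 1 / 5) : Real.exp (-(5 / 4 * y)) ≤ 1 - y := by
  have h := Real.add_one_le_exp (5 / 4 * y)
  rw [Real.exp_neg]
  apply inv_le_of_inv_le₀ (by linarith)
  refine le_trans ?_ h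
  rw [inv_le_iff_one_le_mul₀ (by linarith)]
  nlinarith

lemma aux_q (n : ℕ) (hn : 1 ≤ n) (p : ℝ) (s : ℤ) :
    qStep n p s = 1 / 2 + (3 * ((1 - p) * s / n) - ((1 - p) * s / n) ^ 3) / 4 := by
  have hn0 : (n : ℝ) ≠ 0 := by positivity
  unfold qStep
  field_simp
  ring

lemma aux_term (n k : ℕ) (δ : ℝ) (h0 : 0 ≤ δ) (h1 : δ ≤ 1 / 10) (hk : 2 * k < n)
    (hd : ((n : ℝ) - 2 * k) ^ 2 ≤ 16 * n) :
    Real.exp (-(5 / 2 * δ ^ 2 * n + 10 * δ * Real.sqrt n)) / 2 ^ n ≤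
      (1 / 2 + δ) ^ k * (1 - (1 / 2 + δ)) ^ (n - k) := by
  obtain ⟨d, rfl⟩ : ∃ d, n = 2 * k + d := ⟨n - 2 * k, by omega⟩
  have e1 : (1 / 2 + δ) ^ k * (1 - (1 / 2 + δ)) ^ (2 * k + d - k) =
      (1 - 4 * δ ^ 2) ^ k * (1 - 2 * δ) ^ d / 2 ^ (2 * k + d) := by
    rw [show 2 * k + d - k = k + d by omega, pow_add, ← mul_assoc, ← mul_pow, pow_add, pow_mul,
      mul_div_mul_comm, ← div_pow, ← div_pow]
    congr 2 <;> ring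
  rw [e1]
  gcongr
  have a1 := aux_exp (4 * δ ^ 2) (by positivity) (by nlinarith)
  have a2 := aux_exp (2 * δ) (by positivity) (by linarith)
  have b1 := pow_le_pow_left₀ (Real.exp_pos _).le a1 k
  have b2 := pow_le_pow_left₀ (Real.exp_pos _).le a2 d
  rw [← Real.exp_nat_mul] at b1 b2
  have hds : (d : ℝ) ≤ 4 * Real.sqrt ((2 * k + d : ℕ) : ℝ) := by
    have hs := Real.sq_sqrt (Nat.cast_nonneg (α := ℝ) (2 * k + d))
    have hs0 := Real.sqrt_nonneg ((2 * k + d : ℕ) : ℝ)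
    apply le_of_sq_le_sq _ (by positivity)
    rw [mul_pow, hs]
    push_cast at hd ⊢
    nlinarith
  calc _ ≤ Real.exp (k * -(5 / 4 * (4 * δ ^ 2)) + d * -(5 / 4 * (2 * δ))) := by
        apply Real.exp_le_exp.2
        have : δ * d ≤ δ * (4 * Real.sqrt ((2 * k + d : ℕ) : ℝ)) := by gcongr
        have h3 : 0 ≤ δ ^ 2 * d := by positivity
        have h4 : 5 / 2 * δ ^ 2 * ((2 * k + d : ℕ) : ℝ) = 5 * (δ ^ 2 * k) + 5 / 2 * (δ ^ 2 * d) := by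
          push_cast; ring
        rw [h4]
        linarith
    _ = _ := Real.exp_add _ _
    _ ≤ _ := mul_le_mul b1 b2 (Real.exp_pos _).le ((Real.exp_pos _).le.trans b1)

open Finset in
lemma aux_pos (p ε : ℝ) (hp0 : 0 < p) (hp1 : p < 1) (hε0 : 0 < ε) (hε : ε < 1 / 4)
    (n : ℕ) (hn : 1 ≤ n) (hN : 8 / ε ≤ Real.sqrt n) (s : ℤ) (hs : 0 < s)
    (hsn : (s : ℝ) ≤ Real.sqrt n / ε) :
    Real.exp (-(9 / (2 * ε ^ 2))) ≤
      ∑ k ∈ range (n + 1), if 2 * k < n then binomProb n p s k else 0 := by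
  classical
  set r := Real.sqrt n with hr
  have hn0 : (0 : ℝ) < n := by exact_mod_cast hn
  have hr0 : 0 < r := Real.sqrt_pos.2 hn0
  have hrr : r ^ 2 = n := Real.sq_sqrt hn0.le
  have hs0 : (0 : ℝ) < s := by exact_mod_cast hs
  set x := (1 - p) * s / n with hx
  have hx0 : 0 ≤ x := by
    have : 0 < 1 - p := by linarith
    positivity
  have hxr : x * r ≤ 1 / ε := by
    have : x * r = (1 - p) * (s / r) := by
      rw [hx, ← hrr]; field_simp
    rw [this]
    have h2 : (s : ℝ) / r ≤ 1 / ε := by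
      rw [div_le_iff₀ hr0]
      calc (s : ℝ) ≤ r / ε := hsn
        _ = _ := by ring
    have h3 : 0 ≤ (s : ℝ) / r := by positivity
    nlinarith
  have hx8 : x ≤ 1 / 8 := by
    have h1 : x * (8 / ε) ≤ 1 / ε := le_trans (by gcongr) hxr
    have h2 : x * (8 / ε) = 8 * x * (1 / ε) := by ring
    rw [h2] at h1
    have : 0 < 1 / ε := by positivity
    have := le_of_mul_le_mul_right (h1.trans_eq (one_mul _).symm) this
    linarith
  set δ := (3 * x - x ^ 3) / 4 with hδ
  have hx3 : 0 ≤ x ^ 3 := by positivity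
  have hx2 : x ^ 2 ≤ 1 := by nlinarith
  have hδ0 : 0 ≤ δ := by
    have : x ^ 3 = x * x ^ 2 := by ring
    rw [hδ]; nlinarith
  have hδx : δ ≤ 3 / 4 * x := by rw [hδ]; linarith
  have hδ1 : δ ≤ 1 / 10 := by linarith
  have hq : qStep n p s = 1 / 2 + δ := aux_q n hn p s
  set e := 1 / ε with he
  have he4 : 4 ≤ e := by
    rw [he, le_div_iff₀ hε0]; linarith
  have hδr : δ * r ≤ 3 / 4 * e := by
    have : δ * r ≤ 3 / 4 * x * r := by gcongr
    linarith
  have hδr0 : 0 ≤ δ * r := by positivity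
  have hfin : Real.exp (-(9 / (2 * ε ^ 2))) ≤
      3 / 16 * Real.exp (-(5 / 2 * δ ^ 2 * n + 10 * δ * r)) := by
    have h1 : Real.exp (-16) ≤ 3 / 16 := by
      rw [Real.exp_neg]
      have := Real.add_one_le_exp (16 : ℝ)
      apply inv_le_of_inv_le₀ (by norm_num)
      norm_num
      linarith
    calc _ ≤ Real.exp (-16 + -(5 / 2 * δ ^ 2 * n + 10 * δ * r)) := by
          apply Real.exp_le_exp.2
          have h2 : 9 / (2 * ε ^ 2) = 9 / 2 * e ^ 2 := by rw [he]; field_simp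
          rw [h2, ← hrr]
          nlinarith
      _ = _ := Real.exp_add _ _
      _ ≤ _ := by gcongr
  have hb0 : ∀ k, 0 ≤ binomProb n p s k := fun k => by
    unfold binomProb
    rw [hq]
    have : 0 ≤ 1 - (1 / 2 + δ) := by linarith
    positivity
  set E := Real.exp (-(5 / 2 * δ ^ 2 * n + 10 * δ * r)) with hE
  have hE0 : 0 < E := Real.exp_pos _
  refine hfin.trans ?_
  calc 3 / 16 * E = E / 2 ^ n * (3 / 16 * 2 ^ n) := by field_simp
    _ ≤ E / 2 ^ n * ∑ k ∈ range (n + 1) with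
      (2 * k < n ∧ ((n : ℝ) - 2 * k) ^ 2 ≤ 16 * n), (n.choose k : ℝ) := by
        have := aux_mass n hn
        gcongr
    _ ≤ ∑ k ∈ range (n + 1) with
      (2 * k < n ∧ ((n : ℝ) - 2 * k) ^ 2 ≤ 16 * n), binomProb n p s k := by
        rw [mul_sum]
        refine sum_le_sum fun k hk => ?_
        obtain ⟨-, h1, h2⟩ := mem_filter.1 hk
        have h3 := aux_term n k δ hδ0 hδ1 h1 h2
        unfold binomProb
        rw [hq, mul_assoc, mul_comm]
        gcongr
    _ ≤ ∑ k ∈ range (n + 1) with 2 * k < n, binomProb n p s k := by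
        apply sum_le_sum_of_subset_of_nonneg
        · intro k hk
          obtain ⟨h0, h1, -⟩ := mem_filter.1 hk
          exact mem_filter.2 ⟨h0, h1⟩
        · intro i _ _; exact hb0 i
    _ = _ := sum_filter _ _

/-- Let `p ∈ (0,1)` and `0 < ε < 1/4`. For all sufficiently large `n`,
if `0 < |s| ≤ √n/ε`, then the majority opinion switches at the next round (the sign of
`s_t` is opposite to that of `s`) with probability at least `e^{−9/(2ε²)}`. -/
theorem majority_switches_with_constant_probability
    (p ε : ℝ) (hp0 : 0 < p) (hp1 : p < 1) (hε0 : 0 < ε) (hε : ε < 1 / 4) :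
    ∃ N : ℕ, ∀ n : ℕ, N ≤ n → ∀ s : ℤ, s ≠ 0 →
      |(s : ℝ)| ≤ Real.sqrt n / ε →
      Real.exp (-(9 / (2 * ε ^ 2))) ≤
        stepProb n p s (fun x => (0 < s → x < 0) ∧ (s < 0 → 0 < x)) := by
  classical
  refine ⟨⌈(8 / ε) ^ 2⌉₊ + 1, fun n hn s hs hsn => ?_⟩
  have hn1 : 1 ≤ n := by omega
  have hN : 8 / ε ≤ Real.sqrt n := by
    apply Real.le_sqrt_of_sq_le
    refine (Nat.le_ceil _).trans ?_
    exact_mod_cast (by omega : ⌈(8 / ε) ^ 2⌉₊ ≤ n)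
  unfold stepProb
  rcases lt_or_gt_of_ne hs with h | h
  · have hsn' : ((-s : ℤ) : ℝ) ≤ Real.sqrt n / ε := by
      push_cast
      exact (neg_le_abs _).trans hsn
    refine (aux_pos p ε hp0 hp1 hε0 hε n hn1 hN (-s) (by omega) hsn').trans (le_of_eq ?_)
    rw [← Finset.sum_range_reflect]
    refine Finset.sum_congr rfl fun k hk => ?_
    have hk' : k ≤ n := by have := Finset.mem_range.1 hk; omega
    rw [show n + 1 - 1 - k = n - k by omega]
    have hb : binomProb n p (-s) (n - k) = binomProb n p s k := by
      have hq : qStep n p (-s) = 1 - qStep n p s := by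
        rw [aux_q n hn1, aux_q n hn1]; push_cast; ring
      unfold binomProb
      rw [hq, Nat.choose_symm hk', Nat.sub_sub_self hk', sub_sub_cancel]
      ring
    rw [hb]
    split_ifs with h1 h2 h2
    · rfl
    · exact absurd ⟨fun _ => by omega, fun _ => by omega⟩ h2
    · have := h2.2 h
      omega
    · rfl
  · refine (aux_pos p ε hp0 hp1 hε0 hε n hn1 hN s h ((le_abs_self _).trans hsn)).trans
      (le_of_eq ?_)
    refine Finset.sum_congr rfl fun k hk => ?_
    split_ifs with h1 h2 h2
    · rfl
    · exact absurd ⟨fun _ => by omega, fun _ => by omega⟩ h2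
    · have := h2.1 h
      omega
    · rfl
end

section
/- Let p > 1/3, let ε > 0 be a constant with ε ≤ (3p−1)/2, and let γ > 0 be a constant. For the 3-Majority dynamics with uniform noise probability p, if s is a bias value with s ≥ (γ/2)·√(n·log n), then P( s_t ≤ (1 − 3ε/4)·s | s_{t−1} = s ) ≥ 1 − n^{−γ²ε²/2⁷}. -/
open MeasureTheory ProbabilityTheory in
/-- Hoeffding's lemma for a two-point distribution on `{1, -1}`. -/
lemma two_point_mgf (q t : ℝ) (hq0 : 0 ≤ q) (hq1 : q ≤ 1) :
    q * Real.exp t + (1 - q) * Real.exp (-t) ≤ Real.exp ((2 * q - 1) * t + t ^ 2 / 2) := by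
  let μ : Measure ℝ := ENNReal.ofReal q • Measure.dirac 1 + ENNReal.ofReal (1 - q) • Measure.dirac (-1)
  have hint : ∀ f : ℝ → ℝ, ∫ x, f x ∂μ = q * f 1 + (1 - q) * f (-1) := by
    intro f
    have h1 : Integrable f (ENNReal.ofReal q • Measure.dirac 1) :=
      (integrable_dirac (by simp)).smul_measure ENNReal.ofReal_ne_top
    have h2 : Integrable f (ENNReal.ofReal (1 - q) • Measure.dirac (-1)) :=
      (integrable_dirac (by simp)).smul_measure ENNReal.ofReal_ne_top
    rw [integral_add_measure h1 h2, integral_smul_measure, integral_smul_measure,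
      integral_dirac, integral_dirac, ENNReal.toReal_ofReal hq0,
      ENNReal.toReal_ofReal (by linarith)]
    simp
  have : IsProbabilityMeasure μ := by
    constructor
    simp only [μ, Measure.add_apply, Measure.smul_apply, measure_univ, smul_eq_mul, mul_one]
    rw [← ENNReal.ofReal_add hq0 (by linarith)]
    simp
  have hb : ∀ᵐ x ∂μ, (id x : ℝ) ∈ Set.Icc (-1 : ℝ) 1 := by
    simp only [μ]
    rw [ae_add_measure_iff]
    constructor
    · apply Measure.ae_smul_measure
      rw [ae_dirac_eq]
      simp
    · apply Measure.ae_smul_measure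
      rw [ae_dirac_eq]
      simp
  have h := (hasSubgaussianMGF_of_mem_Icc (X := id) (μ := μ) aemeasurable_id hb).mgf_le t
  unfold mgf at h
  rw [hint, hint] at h
  have hc : (((‖(1 : ℝ) - -1‖₊ / 2) ^ 2 : NNReal) : ℝ) = 1 := by
    norm_num
  rw [hc] at h
  simp only [id] at h
  have e1 : Real.exp ((2 * q - 1) * t + t ^ 2 / 2) =
      Real.exp ((2 * q - 1) * t) * Real.exp (1 * t ^ 2 / 2) := by
    rw [← Real.exp_add]; congr 1; ring
  have e2 : Real.exp t = Real.exp ((2 * q - 1) * t) *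
      Real.exp (t * (1 - (q * 1 + (1 - q) * -1))) := by
    rw [← Real.exp_add]; congr 1; ring
  have e3 : Real.exp (-t) = Real.exp ((2 * q - 1) * t) *
      Real.exp (t * (-1 - (q * 1 + (1 - q) * -1))) := by
    rw [← Real.exp_add]; congr 1; ring
  rw [e1, e2, e3]
  have := mul_le_mul_of_nonneg_left h (Real.exp_pos ((2 * q - 1) * t)).le
  linarith

/-- Exponential Chernoff bound for the binomial distribution. -/
lemma stepProb_chernoff (n : ℕ) (p : ℝ) (s : ℤ) (c t : ℝ) (ht : 0 ≤ t)
    (hq0 : 0 ≤ qStep n p s) (hq1 : qStep n p s ≤ 1) :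
    1 - Real.exp (n * ((2 * qStep n p s - 1) * t + t ^ 2 / 2) - t * c) ≤
      stepProb n p s (fun x => (x : ℝ) ≤ c) := by
  classical
  set q := qStep n p s with hq
  have hnn : ∀ k, 0 ≤ binomProb n p s k := by
    intro k
    unfold binomProb
    rw [← hq]
    have : 0 ≤ 1 - q := by linarith
    positivity
  have hsum : ∑ k ∈ Finset.range (n + 1), binomProb n p s k = 1 := by
    have h := add_pow q (1 - q) n
    rw [show q + (1 - q) = 1 by ring, one_pow] at h
    rw [h]
    refine Finset.sum_congr rfl fun k _ => ?_
    unfold binomProb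
    rw [← hq]; ring
  have hmgf : ∑ k ∈ Finset.range (n + 1),
      binomProb n p s k * Real.exp (t * (2 * k - n - c)) =
      (q * Real.exp t + (1 - q) * Real.exp (-t)) ^ n * Real.exp (-(t * c)) := by
    rw [add_pow, Finset.sum_mul]
    refine Finset.sum_congr rfl fun k hk => ?_
    have hk' : k ≤ n := Nat.lt_succ_iff.mp (Finset.mem_range.mp hk)
    unfold binomProb
    rw [← hq, mul_pow, mul_pow, ← Real.exp_nat_mul, ← Real.exp_nat_mul]
    have : Real.exp (t * (2 * k - n - c)) =
        Real.exp (k * t) * Real.exp (((n - k : ℕ) : ℝ) * -t) * Real.exp (-(t * c)) := by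
      rw [← Real.exp_add, ← Real.exp_add, Nat.cast_sub hk']; congr 1; ring
    rw [this]; ring
  have hbound : (q * Real.exp t + (1 - q) * Real.exp (-t)) ^ n * Real.exp (-(t * c)) ≤
      Real.exp (n * ((2 * q - 1) * t + t ^ 2 / 2) - t * c) := by
    rw [sub_eq_add_neg _ (t * c), Real.exp_add, Real.exp_nat_mul]
    have h0 : 0 ≤ 1 - q := by linarith
    gcongr
    exact two_point_mgf q t hq0 hq1
  have hkey : ∑ k ∈ Finset.range (n + 1), binomProb n p s k ≤
      stepProb n p s (fun x => (x : ℝ) ≤ c) + ∑ k ∈ Finset.range (n + 1),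
        binomProb n p s k * Real.exp (t * (2 * k - n - c)) := by
    unfold stepProb
    rw [← Finset.sum_add_distrib]
    refine Finset.sum_le_sum fun k _ => ?_
    have h1 := hnn k
    split_ifs with h
    · have := mul_nonneg h1 (Real.exp_pos (t * (2 * k - n - c))).le
      linarith
    · push_cast at h
      have : 1 ≤ Real.exp (t * (2 * k - n - c)) := by
        apply Real.one_le_exp
        apply mul_nonneg ht
        linarith
      nlinarith
  linarith

theorem bias_decreases_under_noise
    (p ε γ : ℝ) (hp1 : 1 / 3 < p) (hp2 : p < 1)
    (hε0 : 0 < ε) (hε : ε ≤ (3 * p - 1) / 2) (hγ : 0 < γ)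
    (n : ℕ) (s : ℤ)
    (hs : γ / 2 * Real.sqrt (n * Real.log n) ≤ (s : ℝ)) (hsn : s ≤ (n : ℤ)) :
    1 - (n : ℝ) ^ (-(γ ^ 2 * ε ^ 2 / 2 ^ 7)) ≤
      stepProb n p s (fun x => (x : ℝ) ≤ (1 - 3 * ε / 4) * (s : ℝ)) := by
  have hs0 : (0 : ℝ) ≤ s := le_trans (by positivity) hs
  rcases Nat.eq_zero_or_pos n with rfl | hn
  · have hs' : s = 0 := le_antisymm (by simpa using hsn) (by exact_mod_cast hs0)
    subst hs'
    have : stepProb 0 p 0 (fun x => (x : ℝ) ≤ (1 - 3 * ε / 4) * ((0 : ℤ) : ℝ)) = 1 := by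
      simp [stepProb, binomProb]
    rw [this]
    have := Real.rpow_nonneg (Nat.cast_nonneg (α := ℝ) 0) (-(γ ^ 2 * ε ^ 2 / 2 ^ 7))
    linarith
  have hn0 : (0 : ℝ) < n := by exact_mod_cast hn
  have hn1 : (1 : ℝ) ≤ n := by exact_mod_cast hn
  have hsn' : (s : ℝ) ≤ n := by exact_mod_cast hsn
  obtain ⟨x, hx⟩ : ∃ x : ℝ, x = s / n := ⟨_, rfl⟩
  have hsx : (s : ℝ) = x * n := by rw [hx]; field_simp
  have hx0 : 0 ≤ x := by rw [hx]; positivity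
  have hx1 : x ≤ 1 := by rw [hx, div_le_one hn0]; exact hsn'
  obtain ⟨y, hy⟩ : ∃ y : ℝ, y = (1 - p) * x := ⟨_, rfl⟩
  have hy0 : 0 ≤ y := by rw [hy]; exact mul_nonneg (by linarith) hx0
  have hy1 : y ≤ 1 := by rw [hy]; nlinarith
  have hqy : qStep n p s = 1 / 2 + (3 * y - y ^ 3) / 4 := by
    unfold qStep
    rw [hsx, hy]
    field_simp
    ring
  have hy3 : 0 ≤ y ^ 3 := by positivity
  have hy31 : y ^ 3 ≤ y := by
    have : y ^ 2 ≤ 1 := by nlinarith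
    nlinarith
  have hq0 : 0 ≤ qStep n p s := by rw [hqy]; linarith
  have hq1 : qStep n p s ≤ 1 := by
    rw [hqy]
    nlinarith [mul_nonneg (sq_nonneg (1 - y)) (by linarith : (0 : ℝ) ≤ y + 2)]
  have hm : 2 * qStep n p s - 1 ≤ (1 - ε) * x := by
    rw [hqy]
    have : 3 / 2 * y ≤ (1 - ε) * x := by
      rw [hy]
      nlinarith
    linarith
  have hch := stepProb_chernoff n p s ((1 - 3 * ε / 4) * s) (ε * x / 4) (by positivity) hq0 hq1
  have hlog : 0 ≤ Real.log n := Real.log_nonneg hn1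
  have hsq : γ ^ 2 / 4 * (n * Real.log n) ≤ (s : ℝ) ^ 2 := by
    have h1 : (γ / 2 * Real.sqrt (n * Real.log n)) ^ 2 ≤ (s : ℝ) ^ 2 := by
      gcongr
    rw [mul_pow, Real.sq_sqrt (by positivity)] at h1
    linarith
  have hsq' : γ ^ 2 / 4 * Real.log n ≤ x ^ 2 * n := by
    rw [hsx] at hsq
    have : n * (γ ^ 2 / 4 * Real.log n) ≤ n * (x ^ 2 * n) := by linarith
    exact le_of_mul_le_mul_left this hn0
  have hexp : Real.exp (n * ((2 * qStep n p s - 1) * (ε * x / 4) + (ε * x / 4) ^ 2 / 2)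
      - (ε * x / 4) * ((1 - 3 * ε / 4) * s)) ≤ (n : ℝ) ^ (-(γ ^ 2 * ε ^ 2 / 2 ^ 7)) := by
    rw [Real.rpow_def_of_pos hn0]
    apply Real.exp_le_exp.mpr
    have h1 : (n : ℝ) * ((2 * qStep n p s - 1) * (ε * x / 4)) ≤
        n * (((1 - ε) * x) * (ε * x / 4)) := by
      gcongr
    have h2 : ε ^ 2 / 32 * (γ ^ 2 / 4 * Real.log n) ≤ ε ^ 2 / 32 * (x ^ 2 * n) := by
      gcongr
    rw [hsx]
    linarith
  linarith
end

section
/- Let p > 1/3 and let γ > 0 be a constant. For the 3-Majority dynamics with uniform noise probability p, if s is a bias value with s ≥ 0, then P( −(γ/2)·√(n·log n) ≤ s_t ≤ s + (γ/2)·√(n·log n) | s_{t−1} = s ) ≥ 1 − 2·n^{−γ²/8}. -/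
open MeasureTheory ProbabilityTheory in
/-- Hoeffding's lemma for a two-point distribution on `{1, -1}`. -/
lemma two_point_hoeffding (q t : ℝ) (h0 : 0 ≤ q) (h1 : q ≤ 1) :
    q * Real.exp t + (1 - q) * Real.exp (-t) ≤ Real.exp (t * (2 * q - 1) + t ^ 2 / 2) := by
  set μ : Measure ℝ := ENNReal.ofReal q • Measure.dirac 1 +
    ENNReal.ofReal (1 - q) • Measure.dirac (-1) with hμ
  have h1' : 0 ≤ 1 - q := by linarith
  have hprob : IsProbabilityMeasure μ := by
    constructor
    simp only [hμ, Measure.add_apply, Measure.smul_apply, measure_univ, smul_eq_mul, mul_one]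
    rw [← ENNReal.ofReal_add h0 h1']
    simp
  have hint : ∀ f : ℝ → ℝ, ∫ x, f x ∂μ = q * f 1 + (1 - q) * f (-1) := by
    intro f
    rw [hμ, integral_add_measure, integral_smul_measure, integral_smul_measure,
      integral_dirac, integral_dirac, ENNReal.toReal_ofReal h0, ENNReal.toReal_ofReal h1']
    · simp
    · exact (integrable_dirac (by simp)).smul_measure ENNReal.ofReal_ne_top
    · exact (integrable_dirac (by simp)).smul_measure ENNReal.ofReal_ne_top
  have hae : ∀ᵐ x ∂μ, x ∈ Set.Icc (-1 : ℝ) 1 := by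
    rw [hμ, ae_add_measure_iff]
    constructor
    · apply Measure.ae_smul_measure
      refine (ae_dirac_iff (p := fun x => x ∈ Set.Icc (-1 : ℝ) 1) measurableSet_Icc).2 ?_
      norm_num
    · apply Measure.ae_smul_measure
      refine (ae_dirac_iff (p := fun x => x ∈ Set.Icc (-1 : ℝ) 1) measurableSet_Icc).2 ?_
      norm_num
  have hsub := hasSubgaussianMGF_of_mem_Icc (X := fun x : ℝ => x) (μ := μ) aemeasurable_id hae
  have hm := hsub.mgf_le t
  have hc : (((‖(1 : ℝ) - (-1)‖₊ / 2) ^ 2 : NNReal) : ℝ) = 1 := by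
    push_cast
    rw [Real.norm_eq_abs]
    norm_num
  rw [hc, mgf, hint, hint] at hm
  have e1 : Real.exp t = Real.exp (t * (2 * q - 1)) *
      Real.exp (t * (1 - (q * 1 + (1 - q) * (-1)))) := by
    rw [← Real.exp_add]; congr 1; ring
  have e2 : Real.exp (-t) = Real.exp (t * (2 * q - 1)) *
      Real.exp (t * (-1 - (q * 1 + (1 - q) * (-1)))) := by
    rw [← Real.exp_add]; congr 1; ring
  rw [e1, e2, Real.exp_add]
  have := mul_le_mul_of_nonneg_left hm (Real.exp_pos (t * (2 * q - 1))).le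
  rw [one_mul] at this
  linarith

/-- Generating function of the one-step bias. -/
lemma step_mgf (n : ℕ) (p : ℝ) (s : ℤ) (t : ℝ) :
    ∑ k ∈ Finset.range (n + 1), binomProb n p s k * Real.exp (t * (2 * (k : ℝ) - n)) =
      (qStep n p s * Real.exp t + (1 - qStep n p s) * Real.exp (-t)) ^ n := by
  rw [add_pow]
  refine Finset.sum_congr rfl fun k hk => ?_
  have hk' : k ≤ n := Nat.lt_succ_iff.mp (Finset.mem_range.mp hk)
  rw [binomProb, mul_pow, mul_pow, ← Real.exp_nat_mul, ← Real.exp_nat_mul]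
  have : Real.exp (t * (2 * (k : ℝ) - n)) =
      Real.exp (k * t) * Real.exp (((n - k : ℕ) : ℝ) * -t) := by
    rw [← Real.exp_add, Nat.cast_sub hk']; congr 1; ring
  rw [this]; ring

lemma qStep_bounds (n : ℕ) (hn : 0 < n) (p : ℝ) (hp1 : 1 / 3 < p) (hp2 : p < 1)
    (s : ℤ) (hs : 0 ≤ s) (hsn : s ≤ (n : ℤ)) :
    0 ≤ 2 * qStep n p s - 1 ∧ (n : ℝ) * (2 * qStep n p s - 1) ≤ s ∧ qStep n p s ≤ 1 := by
  have hnR : (0 : ℝ) < n := by exact_mod_cast hn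
  have hsR : (0 : ℝ) ≤ s := by exact_mod_cast hs
  have hsnR : (s : ℝ) ≤ n := by exact_mod_cast hsn
  obtain ⟨x, hx⟩ : ∃ x : ℝ, x = s / n := ⟨_, rfl⟩
  have hsx : (s : ℝ) = n * x := by rw [hx]; field_simp
  have hx0 : 0 ≤ x := by rw [hx]; positivity
  have hx1 : x ≤ 1 := by rw [hx, div_le_one hnR]; exact hsnR
  obtain ⟨y, hy⟩ : ∃ y : ℝ, y = x * (1 - p) := ⟨_, rfl⟩
  have hq : 2 * qStep n p s - 1 = (3 * y - y ^ 3) / 2 := by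
    have e1 : ((n : ℝ) + s) / (2 * n) = (1 + x) / 2 := by rw [hsx]; field_simp
    have e2 : ((n : ℝ) - s) / (2 * n) = (1 - x) / 2 := by rw [hsx]; field_simp
    rw [qStep, e1, e2, hy]; ring
  have hy0 : 0 ≤ y := by rw [hy]; exact mul_nonneg hx0 (by linarith)
  have hyx : 3 * y ≤ 2 * x := by rw [hy]; nlinarith
  have hy1 : y ≤ 1 := by linarith
  have hy3 : 0 ≤ y ^ 3 := by positivity
  have hy3' : y ^ 3 ≤ y := by
    have : y ^ 2 ≤ 1 := pow_le_one₀ hy0 hy1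
    nlinarith
  refine ⟨by rw [hq]; linarith, ?_, by linarith⟩
  rw [hq, hsx]
  exact mul_le_mul_of_nonneg_left (by linarith) hnR.le

/-- Let `p > 1/3` and `γ > 0`. If `s ≥ 0`, then
`P(−(γ/2)√(n log n) ≤ s_t ≤ s + (γ/2)√(n log n) | s_{t−1} = s) ≥ 1 − 2n^{−γ²/8}`. -/
theorem bias_does_not_jump_under_noise
    (p γ : ℝ) (hp1 : 1 / 3 < p) (hp2 : p < 1) (hγ : 0 < γ)
    (n : ℕ) (s : ℤ) (hs : 0 ≤ s) (hsn : s ≤ (n : ℤ)) :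
    1 - 2 * (n : ℝ) ^ (-(γ ^ 2 / 8)) ≤
      stepProb n p s
        (fun x => -(γ / 2) * Real.sqrt (n * Real.log n) ≤ (x : ℝ) ∧
          (x : ℝ) ≤ (s : ℝ) + γ / 2 * Real.sqrt (n * Real.log n)) := by
  rcases Nat.eq_zero_or_pos n with rfl | hn
  · have hs0 : s = 0 := le_antisymm (by simpa using hsn) hs
    subst hs0
    have h : -(γ ^ 2 / 8) ≠ 0 := by
      have : 0 < γ ^ 2 := by positivity
      linarith
    simp only [Nat.cast_zero, Real.zero_rpow h]
    simp [stepProb, binomProb]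
  have hnR : (0 : ℝ) < n := by exact_mod_cast hn
  have hn1 : (1 : ℝ) ≤ n := by exact_mod_cast hn
  obtain ⟨hm0, hms, hq1⟩ := qStep_bounds n hn p hp1 hp2 s hs hsn
  have hq0 : 0 ≤ qStep n p s := by linarith
  have hlog : 0 ≤ Real.log n := Real.log_nonneg hn1
  obtain ⟨l, hl⟩ : ∃ l : ℝ, l = γ / 2 * Real.sqrt (n * Real.log n) := ⟨_, rfl⟩
  have hl0 : 0 ≤ l := by rw [hl]; positivity
  have hl2 : l ^ 2 = γ ^ 2 / 4 * (n * Real.log n) := by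
    rw [hl, mul_pow, Real.sq_sqrt (by positivity)]; ring
  obtain ⟨t, ht⟩ : ∃ t : ℝ, t = l / n := ⟨_, rfl⟩
  have ht0 : 0 ≤ t := by rw [ht]; positivity
  have hexp : (n : ℝ) ^ (-(γ ^ 2 / 8)) = Real.exp (-(t * l) + n * (t ^ 2 / 2)) := by
    rw [Real.rpow_def_of_pos hnR]
    congr 1
    have : -(t * l) + n * (t ^ 2 / 2) = -(l ^ 2 / (2 * n)) := by
      rw [ht]; field_simp; ring
    rw [this, hl2]; field_simp; ring
  -- MGF bounds
  have hM : ∀ u : ℝ, (qStep n p s * Real.exp u + (1 - qStep n p s) * Real.exp (-u)) ^ n ≤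
      Real.exp (n * (u * (2 * qStep n p s - 1) + u ^ 2 / 2)) := by
    intro u
    rw [Real.exp_nat_mul]
    refine pow_le_pow_left₀ ?_ (two_point_hoeffding _ u hq0 hq1) n
    have := mul_nonneg hq0 (Real.exp_pos u).le
    have := mul_nonneg (sub_nonneg.2 hq1) (Real.exp_pos (-u)).le
    linarith
  have hU : Real.exp (-(t * (s + l))) *
      (qStep n p s * Real.exp t + (1 - qStep n p s) * Real.exp (-t)) ^ n ≤
      (n : ℝ) ^ (-(γ ^ 2 / 8)) := by
    refine (mul_le_mul_of_nonneg_left (hM t) (Real.exp_pos _).le).trans ?_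
    rw [hexp, ← Real.exp_add]
    apply Real.exp_le_exp.2
    have := mul_le_mul_of_nonneg_left hms ht0
    linarith
  have hL : Real.exp (-(t * l)) *
      (qStep n p s * Real.exp (-t) + (1 - qStep n p s) * Real.exp (- -t)) ^ n ≤
      (n : ℝ) ^ (-(γ ^ 2 / 8)) := by
    refine (mul_le_mul_of_nonneg_left (hM (-t)) (Real.exp_pos _).le).trans ?_
    rw [hexp, ← Real.exp_add]
    apply Real.exp_le_exp.2
    have := mul_nonneg (mul_nonneg hnR.le ht0) hm0
    linarith
  have h1 := step_mgf n p s 0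
  simp only [zero_mul, Real.exp_zero, mul_one, neg_zero, add_sub_cancel, one_pow] at h1
  rw [← step_mgf, Finset.mul_sum] at hU hL
  have key : ∑ k ∈ Finset.range (n + 1), (binomProb n p s k
      - Real.exp (-(t * (s + l))) * (binomProb n p s k * Real.exp (t * (2 * (k : ℝ) - n)))
      - Real.exp (-(t * l)) * (binomProb n p s k * Real.exp (-t * (2 * (k : ℝ) - n)))) ≤
      stepProb n p s
        (fun x => -(γ / 2) * Real.sqrt (n * Real.log n) ≤ (x : ℝ) ∧
          (x : ℝ) ≤ (s : ℝ) + γ / 2 * Real.sqrt (n * Real.log n)) := by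
    rw [stepProb]
    refine Finset.sum_le_sum fun k _ => ?_
    have hP : 0 ≤ binomProb n p s k := by
      rw [binomProb]
      have := pow_nonneg (sub_nonneg.2 hq1) (n - k)
      positivity
    have eA : Real.exp (-(t * (s + l))) * (binomProb n p s k * Real.exp (t * (2 * (k : ℝ) - n)))
        = binomProb n p s k * Real.exp (t * ((2 * (k : ℝ) - n) - (s + l))) := by
      rw [mul_left_comm, ← Real.exp_add]; congr 2; ring
    have eB : Real.exp (-(t * l)) * (binomProb n p s k * Real.exp (-t * (2 * (k : ℝ) - n)))
        = binomProb n p s k * Real.exp (t * (-l - (2 * (k : ℝ) - n))) := by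
      rw [mul_left_comm, ← Real.exp_add]; congr 2; ring
    rw [eA, eB, neg_mul, ← hl]
    have pA := mul_nonneg hP (Real.exp_pos (t * ((2 * (k : ℝ) - n) - (s + l)))).le
    have pB := mul_nonneg hP (Real.exp_pos (t * (-l - (2 * (k : ℝ) - n)))).le
    split_ifs with hc
    · linarith
    · push_cast at hc
      rw [not_and_or, not_le, not_le] at hc
      rcases hc with hc | hc
      · have : 1 ≤ Real.exp (t * (-l - (2 * (k : ℝ) - n))) :=
          Real.one_le_exp (mul_nonneg ht0 (by linarith))
        have := mul_le_mul_of_nonneg_left this hP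
        linarith
      · have : 1 ≤ Real.exp (t * ((2 * (k : ℝ) - n) - (s + l))) :=
          Real.one_le_exp (mul_nonneg ht0 (by linarith))
        have := mul_le_mul_of_nonneg_left this hP
        linarith
  rw [Finset.sum_sub_distrib, Finset.sum_sub_distrib, h1] at key
  linarith
end
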